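/- Let m, n ≥ 0 be integers and let N be a real number. With [s]_N := sin(2πs/N)/sin(2π/N), α_t := [2t][t+1][t-1]/([2t+2][t]^2), β_t := [t-1]/([t][2]), A_i := -[6][2]/[3] + α_{m+i} + α_{n+i} + ([6][2]/[3])(β_{n+i} + β_{m+i}) - [4][2] β_{n+i} β_{m+i}, and B_k := α_{n+k} α_{m+k}, define Θ(m,n,p) recursively by Θ(m,n,0) := [2(m+n)+4][m+n+3][m+n+1]/([4][3]) and Θ(m,n,p) := ( A_p + Σ_{i=1}^{p-1} A_i · ∏_{k=i+1}^{p} B_k ) · Θ(m,n,p-1) for p ≥ 1. Then for every integer p ≥ 0 with N > 8(m + n + p + 1), one has Θ(m,n,p) ≠ 0. (Θ(m,n,p) is, up to sign, the value of the theta net θ((a,0),(b,0),(c,0)) with a = m+p, b = m+n, c = n+p; this is the numerical content of the theorem that θ(a,b,c) ≠ 0 when q is a root of unity of sufficiently large order.) -/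

import Mathlib

/-- Root-of-unity quantum integer `[s]_N = sin(2πs/N)/sin(2π/N)`, corresponding to
specializing the quantum integer at `q = e^{2πi/N}`. -/
noncomputable def qiN (N : ℝ) (s : ℤ) : ℝ :=
  Real.sin (2 * Real.pi * s / N) / Real.sin (2 * Real.pi / N)

/-- The coefficient `α_t = [2t][t+1][t-1]/([2t+2][t]^2)`. -/
noncomputable def alphaN (N : ℝ) (t : ℤ) : ℝ :=
  qiN N (2 * t) * qiN N (t + 1) * qiN N (t - 1) / (qiN N (2 * t + 2) * (qiN N t) ^ 2)

/-- The coefficient `β_t = [t-1]/([t][2])`. -/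
noncomputable def betaN (N : ℝ) (t : ℤ) : ℝ :=
  qiN N (t - 1) / (qiN N t * qiN N 2)

/-- The coefficient
`A_i = -[6][2]/[3] + α_{m+i} + α_{n+i} + ([6][2]/[3])(β_{n+i}+β_{m+i}) - [4][2]β_{n+i}β_{m+i}`. -/
noncomputable def coeffA (N : ℝ) (m n : ℕ) (i : ℕ) : ℝ :=
  -(qiN N 6 * qiN N 2) / qiN N 3 + alphaN N ((m : ℤ) + i) + alphaN N ((n : ℤ) + i)
    + (qiN N 6 * qiN N 2 / qiN N 3) * (betaN N ((n : ℤ) + i) + betaN N ((m : ℤ) + i))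
    - qiN N 4 * qiN N 2 * (betaN N ((n : ℤ) + i) * betaN N ((m : ℤ) + i))

/-- The coefficient `B_k = α_{n+k} α_{m+k}`. -/
noncomputable def coeffB (N : ℝ) (m n : ℕ) (k : ℕ) : ℝ :=
  alphaN N ((n : ℤ) + k) * alphaN N ((m : ℤ) + k)

/-- The recursively defined value `Θ(m,n,p)` of the theta net (up to sign):
`Θ(m,n,0) = [2(m+n)+4][m+n+3][m+n+1]/([4][3])` and
`Θ(m,n,p) = (A_p + Σ_{i=1}^{p-1} A_i ∏_{k=i+1}^p B_k)·Θ(m,n,p-1)`. -/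
noncomputable def Theta (N : ℝ) (m n : ℕ) : ℕ → ℝ
  | 0 => qiN N (2 * ((m : ℤ) + n) + 4) * qiN N ((m : ℤ) + n + 3) * qiN N ((m : ℤ) + n + 1)
      / (qiN N 4 * qiN N 3)
  | p + 1 =>
      (coeffA N m n (p + 1) + ∑ i ∈ Finset.Icc 1 p,
          coeffA N m n i * ∏ k ∈ Finset.Icc (i + 1) (p + 1), coeffB N m n k)
        * Theta N m n p

lemma qiN_pos {N : ℝ} {s : ℤ} (hs : 1 ≤ s) (hN : 2 * (s : ℝ) < N) : 0 < qiN N s := by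
  have hs' : (1 : ℝ) ≤ s := by exact_mod_cast hs
  have hN0 : 0 < N := by linarith
  have hpi := Real.pi_pos
  unfold qiN
  apply div_pos <;> apply Real.sin_pos_of_pos_of_lt_pi
  · positivity
  · rw [div_lt_iff₀ hN0]; nlinarith
  · positivity
  · rw [div_lt_iff₀ hN0]; nlinarith

/-- The variable `tan θ · cot (tθ)` with `θ = 2π/N`, in which `α_t` and `β_t` are rational. -/
noncomputable def tanRatio (N : ℝ) (t : ℤ) : ℝ :=
  Real.tan (2 * Real.pi / N) * Real.cot (t * (2 * Real.pi / N))

lemma qiN_eq (N : ℝ) (s : ℤ) :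
    qiN N s = Real.sin (s * (2 * Real.pi / N)) / Real.sin (2 * Real.pi / N) := by
  unfold qiN
  congr 2
  ring

lemma angle_bounds {N : ℝ} {t : ℤ} (ht : 1 ≤ t) (hN : 8 * ((t : ℝ) + 1) < N) :
    0 < 2 * Real.pi / N ∧ 2 * Real.pi / N ≤ t * (2 * Real.pi / N) ∧
      t * (2 * Real.pi / N) + 2 * Real.pi / N < Real.pi / 4 := by
  have ht' : (1 : ℝ) ≤ t := by exact_mod_cast ht
  have hN0 : 0 < N := by linarith
  have hpi := Real.pi_pos
  have hθ : 0 < 2 * Real.pi / N := by positivity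
  refine ⟨hθ, by nlinarith, ?_⟩
  have : (t : ℝ) * (2 * Real.pi / N) + 2 * Real.pi / N = (t + 1) * (2 * Real.pi) / N := by ring
  rw [this, div_lt_iff₀ hN0]
  nlinarith

lemma trig_bounds {θ x : ℝ} (hθ : 0 < θ) (hθx : θ ≤ x) (hx : x + θ < Real.pi / 4) :
    0 < Real.sin θ ∧ 0 < Real.cos θ ∧ 0 < Real.sin x ∧ 0 < Real.cos x ∧
      0 ≤ Real.sin x * Real.cos θ - Real.cos x * Real.sin θ ∧
      0 < Real.sin x * Real.cos θ + Real.cos x * Real.sin θ ∧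
      Real.sin x * Real.cos θ + Real.cos x * Real.sin θ <
        Real.cos x * Real.cos θ - Real.sin x * Real.sin θ := by
  have hpi := Real.pi_pos
  refine ⟨Real.sin_pos_of_pos_of_lt_pi hθ (by linarith),
    Real.cos_pos_of_mem_Ioo ⟨by linarith, by linarith⟩,
    Real.sin_pos_of_pos_of_lt_pi (by linarith) (by linarith),
    Real.cos_pos_of_mem_Ioo ⟨by linarith, by linarith⟩, ?_, ?_, ?_⟩
  · rw [← Real.sin_sub]
    exact Real.sin_nonneg_of_nonneg_of_le_pi (by linarith) (by linarith)
  · rw [← Real.sin_add]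
    exact Real.sin_pos_of_pos_of_lt_pi (by linarith) (by linarith)
  · rw [← Real.sin_add, ← Real.cos_add, ← Real.sin_pi_div_two_sub]
    exact Real.sin_lt_sin_of_lt_of_le_pi_div_two (by linarith) (by linarith) (by linarith)

lemma betaN_eq {N : ℝ} {t : ℤ} (ht : 1 ≤ t) (hN : 8 * ((t : ℝ) + 1) < N) :
    betaN N t = (1 - tanRatio N t) / 2 := by
  obtain ⟨h1, h2, h3⟩ := angle_bounds ht hN
  unfold betaN tanRatio
  simp only [qiN_eq]
  push_cast
  rw [sub_mul, one_mul, Real.sin_sub, Real.sin_two_mul, Real.tan_eq_sin_div_cos,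
    Real.cot_eq_cos_div_sin]
  obtain ⟨hs, hc, hS, hC, -⟩ := trig_bounds h1 h2 h3
  generalize (t : ℝ) * (2 * Real.pi / N) = x at *
  generalize 2 * Real.pi / N = θ at *
  field_simp

lemma alphaN_eq {N : ℝ} {t : ℤ} (ht : 1 ≤ t) (hN : 8 * ((t : ℝ) + 1) < N) :
    alphaN N t = tanRatio N t * (1 - tanRatio N t) /
      (tanRatio N t - Real.tan (2 * Real.pi / N) ^ 2) := by
  obtain ⟨h1, h2, h3⟩ := angle_bounds ht hN
  unfold alphaN tanRatio
  simp only [qiN_eq]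
  push_cast
  generalize 2 * Real.pi / N = θ at *
  obtain ⟨hs, hc, hS, hC, h4, h5, h6⟩ := trig_bounds h1 h2 h3
  rw [show (2 * (t : ℝ) + 2) * θ = 2 * (t * θ + θ) by ring, mul_assoc 2 (t : ℝ) θ,
    sub_mul, add_mul, one_mul, Real.sin_two_mul, Real.sin_two_mul, Real.sin_sub, Real.sin_add,
    Real.cos_add, Real.tan_eq_sin_div_cos, Real.cot_eq_cos_div_sin]
  generalize Real.sin (t * θ) = S at *
  generalize Real.cos (t * θ) = K at *
  generalize Real.sin θ = s at *
  generalize Real.cos θ = c at *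
  have h7 : 0 < K * c - S * s := h5.trans h6
  have e : s / c * (K / S) - (s / c) ^ 2 = s * (K * c - S * s) / (c ^ 2 * S) := by
    field_simp
  rw [e]
  field_simp

lemma tanRatio_bounds {N : ℝ} {t : ℤ} (ht : 1 ≤ t) (hN : 8 * ((t : ℝ) + 1) < N) :
    0 < Real.tan (2 * Real.pi / N) ∧ Real.tan (2 * Real.pi / N) < 1 ∧ tanRatio N t ≤ 1 ∧
    Real.tan (2 * Real.pi / N) * (1 + Real.tan (2 * Real.pi / N)) <
      tanRatio N t * (1 - Real.tan (2 * Real.pi / N)) := by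
  obtain ⟨h1, h2, h3⟩ := angle_bounds ht hN
  unfold tanRatio
  generalize 2 * Real.pi / N = θ at *
  obtain ⟨hs, hc, hS, hC, h4, h5, h6⟩ := trig_bounds h1 h2 h3
  rw [Real.tan_eq_sin_div_cos, Real.cot_eq_cos_div_sin]
  generalize Real.sin (t * θ) = S at *
  generalize Real.cos (t * θ) = K at *
  generalize Real.sin θ = s at *
  generalize Real.cos θ = c at *
  refine ⟨by positivity, ?_, ?_, ?_⟩
  · rw [div_lt_one hc]
    nlinarith
  · rw [div_mul_div_comm, div_le_one (by positivity)]
    linarith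
  · rw [← sub_pos]
    have e : s / c * (K / S) * (1 - s / c) - s / c * (1 + s / c) =
        s * (K * c - S * s - (S * c + K * s)) / (c ^ 2 * S) := by
      field_simp
      ring
    rw [e]
    exact div_pos (mul_pos hs (sub_pos.2 h6)) (by positivity)

lemma alphaN_bounds {N : ℝ} {t : ℤ} (ht : 1 ≤ t) (hN : 8 * ((t : ℝ) + 1) < N) :
    0 ≤ alphaN N t ∧ alphaN N t ≤ (1 + Real.tan (2 * Real.pi / N)) /
      (1 + Real.tan (2 * Real.pi / N) ^ 2) * (1 - tanRatio N t) := by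
  obtain ⟨h0, h1, hu, hl⟩ := tanRatio_bounds ht hN
  rw [alphaN_eq ht hN]
  generalize Real.tan (2 * Real.pi / N) = τ at *
  generalize tanRatio N t = u at *
  have hw : 0 < u - τ ^ 2 := by nlinarith
  have hu0 : 0 < u := by nlinarith
  refine ⟨div_nonneg (mul_nonneg hu0.le (by linarith)) hw.le, ?_⟩
  rw [mul_div_right_comm]
  refine mul_le_mul_of_nonneg_right ?_ (by linarith)
  rw [div_le_div_iff₀ hw (by positivity)]
  nlinarith

lemma qiN_six_mul_two_div_three {N : ℝ} (hN : 16 < N) :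
    qiN N 6 * qiN N 2 / qiN N 3 = 4 * (1 - 3 * Real.tan (2 * Real.pi / N) ^ 2) /
      (1 + Real.tan (2 * Real.pi / N) ^ 2) ^ 2 := by
  have h3 : 0 < qiN N 3 := qiN_pos (by norm_num) (by norm_num; linarith)
  obtain ⟨h1, h2, h4⟩ := angle_bounds (N := N) (t := 1) le_rfl (by norm_num; linarith)
  obtain ⟨hs, hc, -⟩ := trig_bounds h1 h2 h4
  rw [div_eq_iff h3.ne']
  simp only [qiN_eq]
  push_cast
  generalize 2 * Real.pi / N = θ at *
  rw [show 6 * θ = 2 * (3 * θ) by ring, Real.sin_two_mul, Real.sin_two_mul, Real.cos_three_mul,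
    Real.tan_eq_sin_div_cos]
  have e : 1 + (Real.sin θ / Real.cos θ) ^ 2 = 1 / Real.cos θ ^ 2 := by
    field_simp
    linarith [Real.sin_sq_add_cos_sq θ]
  rw [e]
  field_simp
  rw [Real.sin_sq]
  ring

lemma qiN_four_mul_two {N : ℝ} (hN : 16 < N) :
    qiN N 4 * qiN N 2 = 8 * (1 - Real.tan (2 * Real.pi / N) ^ 2) /
      (1 + Real.tan (2 * Real.pi / N) ^ 2) ^ 2 := by
  obtain ⟨h1, h2, h4⟩ := angle_bounds (N := N) (t := 1) le_rfl (by norm_num; linarith)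
  obtain ⟨hs, hc, -⟩ := trig_bounds h1 h2 h4
  simp only [qiN_eq]
  push_cast
  generalize 2 * Real.pi / N = θ at *
  rw [show 4 * θ = 2 * (2 * θ) by ring, Real.sin_two_mul, Real.sin_two_mul, Real.cos_two_mul,
    Real.tan_eq_sin_div_cos]
  have e : 1 + (Real.sin θ / Real.cos θ) ^ 2 = 1 / Real.cos θ ^ 2 := by
    field_simp
    linarith [Real.sin_sq_add_cos_sq θ]
  rw [e]
  field_simp
  rw [Real.sin_sq]
  ring

/-- A bilinear function that is negative at the corners of a square is negative on the square. -/
lemma bilinear_neg {G C D X x y : ℝ} (hX : 0 < X) (hx : 0 ≤ x) (hxX : x ≤ X) (hy : 0 ≤ y)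
    (hyX : y ≤ X) (hC : 0 < C) (h₁ : G * X < 2 * C) (h₂ : 2 * G * X < 2 * C + D * X ^ 2) :
    G * (x + y) - 2 * C - D * (x * y) < 0 := by
  have e : X ^ 2 * (G * (x + y) - 2 * C - D * (x * y)) =
      -((X - x) * (X - y) * (2 * C) + (x * (X - y) + (X - x) * y) * (2 * C - G * X)
        + x * y * (2 * C + D * X ^ 2 - 2 * G * X)) := by ring
  have hx' := sub_nonneg.2 hxX
  have hy' := sub_nonneg.2 hyX
  obtain ⟨ε, hε, a1, a2, a3⟩ : ∃ ε > 0, ε ≤ 2 * C ∧ ε ≤ 2 * C - G * X ∧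
      ε ≤ 2 * C + D * X ^ 2 - 2 * G * X :=
    ⟨min (2 * C) (min (2 * C - G * X) (2 * C + D * X ^ 2 - 2 * G * X)),
      by simp only [gt_iff_lt, lt_min_iff]; refine ⟨?_, ?_, ?_⟩ <;> linarith,
      min_le_left _ _, (min_le_right _ _).trans (min_le_left _ _),
      (min_le_right _ _).trans (min_le_right _ _)⟩
  have b1 := mul_le_mul_of_nonneg_left a1 (mul_nonneg hx' hy')
  have b2 := mul_le_mul_of_nonneg_left a2
    (add_nonneg (mul_nonneg hx hy') (mul_nonneg hx' hy))
  have b3 := mul_le_mul_of_nonneg_left a3 (mul_nonneg hx hy)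
  have hX2 : 0 < X ^ 2 := by positivity
  have hεX := mul_pos hX2 hε
  by_contra! h
  have := mul_nonneg hX2.le h
  nlinarith

lemma rational_corner_bound {τ u v : ℝ} (h0 : 0 < τ) (h1 : τ < 1) (hu : u ≤ 1) (hv : v ≤ 1)
    (hul : τ * (1 + τ) < u * (1 - τ)) (hvl : τ * (1 + τ) < v * (1 - τ)) :
    (1 + τ) / (1 + τ ^ 2) * ((1 - u) + (1 - v))
      - 2 * (1 - 3 * τ ^ 2) / (1 + τ ^ 2) ^ 2 * (u + v)
      - 2 * (1 - τ ^ 2) / (1 + τ ^ 2) ^ 2 * ((1 - u) * (1 - v)) < 0 := by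
  have h1' : 0 < 1 - τ := by linarith
  have hτ : 0 < 1 - 2 * τ - τ ^ 2 := by nlinarith
  have hτ2 : τ < 1 / 2 := by nlinarith
  have hw : 0 < 1 + τ ^ 2 := by positivity
  have key := bilinear_neg
    (G := (1 + τ) / (1 + τ ^ 2) + 2 * (1 - 3 * τ ^ 2) / (1 + τ ^ 2) ^ 2)
    (C := 2 * (1 - 3 * τ ^ 2) / (1 + τ ^ 2) ^ 2)
    (D := 2 * (1 - τ ^ 2) / (1 + τ ^ 2) ^ 2)
    (X := (1 - 2 * τ - τ ^ 2) / (1 - τ)) (x := 1 - u) (y := 1 - v)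
    (div_pos hτ h1') (by linarith) (by rw [le_div_iff₀ h1']; linarith) (by linarith)
    (by rw [le_div_iff₀ h1']; linarith)
    (div_pos (by nlinarith) (by positivity)) ?_ ?_
  · convert key using 1
    ring
  · rw [← sub_pos]
    have e : 2 * (2 * (1 - 3 * τ ^ 2) / (1 + τ ^ 2) ^ 2) -
        ((1 + τ) / (1 + τ ^ 2) + 2 * (1 - 3 * τ ^ 2) / (1 + τ ^ 2) ^ 2) *
          ((1 - 2 * τ - τ ^ 2) / (1 - τ)) =
        (2 * (1 - 3 * τ ^ 2) - (1 + τ) * (1 - 2 * τ - τ ^ 2)) / ((1 - τ) * (1 + τ ^ 2)) := by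
      field_simp
      ring
    rw [e]
    refine div_pos ?_ (by positivity)
    nlinarith [mul_pos h0 h0, mul_pos h0 (mul_pos h0 h0)]
  · rw [← sub_pos]
    have e : 2 * (2 * (1 - 3 * τ ^ 2) / (1 + τ ^ 2) ^ 2) +
        2 * (1 - τ ^ 2) / (1 + τ ^ 2) ^ 2 * ((1 - 2 * τ - τ ^ 2) / (1 - τ)) ^ 2 -
        2 * ((1 + τ) / (1 + τ ^ 2) + 2 * (1 - 3 * τ ^ 2) / (1 + τ ^ 2) ^ 2) *
          ((1 - 2 * τ - τ ^ 2) / (1 - τ)) =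
        4 * τ ^ 2 * (1 + τ) / ((1 - τ) * (1 + τ ^ 2)) := by
      field_simp
      ring
    rw [e]
    positivity

lemma coeffA_neg {N : ℝ} {m n i : ℕ} (hi : 1 ≤ i) (hm : 8 * ((m : ℝ) + i + 1) < N)
    (hn : 8 * ((n : ℝ) + i + 1) < N) : coeffA N m n i < 0 := by
  have hi' : (1 : ℝ) ≤ i := by exact_mod_cast hi
  have hN : 16 < N := by linarith [(Nat.cast_nonneg m : (0 : ℝ) ≤ m)]
  have hm1 : (1 : ℤ) ≤ (m : ℤ) + i := by omega
  have hn1 : (1 : ℤ) ≤ (n : ℤ) + i := by omega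
  have hm2 : 8 * ((((m : ℤ) + i : ℤ) : ℝ) + 1) < N := by push_cast; exact hm
  have hn2 : 8 * ((((n : ℤ) + i : ℤ) : ℝ) + 1) < N := by push_cast; exact hn
  obtain ⟨h0, h1, hu, hul⟩ := tanRatio_bounds hm1 hm2
  obtain ⟨-, -, hv, hvl⟩ := tanRatio_bounds hn1 hn2
  have key := rational_corner_bound h0 h1 hu hv hul hvl
  have ham := (alphaN_bounds hm1 hm2).2
  have han := (alphaN_bounds hn1 hn2).2
  unfold coeffA
  rw [neg_div, betaN_eq hm1 hm2, betaN_eq hn1 hn2, qiN_six_mul_two_div_three hN,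
    qiN_four_mul_two hN]
  refine lt_of_le_of_lt ?_ key
  linear_combination ham + han

lemma coeffB_nonneg {N : ℝ} {m n k : ℕ} (hk : 1 ≤ k) (hm : 8 * ((m : ℝ) + k + 1) < N)
    (hn : 8 * ((n : ℝ) + k + 1) < N) : 0 ≤ coeffB N m n k :=
  mul_nonneg (alphaN_bounds (by omega) (by push_cast; exact hn)).1
    (alphaN_bounds (by omega) (by push_cast; exact hm)).1

/-- Nonvanishing of the theta net at roots of unity of sufficiently large order:
if `N > 8(m+n+p+1)` then `Θ(m,n,p) ≠ 0`. -/
theorem theta_ne_zero (m n : ℕ) :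
    ∀ p : ℕ, ∀ N : ℝ, 8 * ((m : ℝ) + n + p + 1) < N → Theta N m n p ≠ 0 := by
  intro p N hN
  have hm0 : (0 : ℝ) ≤ m := Nat.cast_nonneg m
  have hn0 : (0 : ℝ) ≤ n := Nat.cast_nonneg n
  induction p with
  | zero =>
    push_cast at hN
    have hq {s : ℤ} (hs : 1 ≤ s) (h : 2 * (s : ℝ) < N) : qiN N s ≠ 0 := (qiN_pos hs h).ne'
    refine div_ne_zero (mul_ne_zero (mul_ne_zero ?_ ?_) ?_) (mul_ne_zero ?_ ?_) <;>
      refine hq (by omega) ?_ <;> push_cast <;> linarith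
  | succ p ih =>
    push_cast at hN
    have hbound {i : ℕ} (hi : i ≤ p + 1) :
        8 * ((m : ℝ) + i + 1) < N ∧ 8 * ((n : ℝ) + i + 1) < N := by
      have : (i : ℝ) ≤ p + 1 := by exact_mod_cast hi
      constructor <;> linarith
    refine mul_ne_zero (ne_of_lt ?_) (ih (by linarith))
    refine add_neg_of_neg_of_nonpos
      (coeffA_neg (by omega) (hbound le_rfl).1 (hbound le_rfl).2) ?_
    refine Finset.sum_nonpos fun i hi => ?_
    rw [Finset.mem_Icc] at hi
    have hi' := hbound (i := i) (by omega)
    refine mul_nonpos_of_nonpos_of_nonneg (coeffA_neg hi.1 hi'.1 hi'.2).le ?_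
    refine Finset.prod_nonneg fun k hk => ?_
    rw [Finset.mem_Icc] at hk
    have hk' := hbound hk.2
    exact coeffB_nonneg (by omega) hk'.1 hk'.2
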